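/- Let T = (T_1,…,T_d) be a commuting row contraction on a Hilbert space H, ξ ∈ H a unit vector, ℓ ∈ ℕ, and ε > 0. Assume (|α|!/α!)·‖T^α ξ‖² ≥ 1 − ε for every multi-index α with |α| = ℓ. Let (c_α) be complex scalars indexed by multi-indices of length ℓ, and let S = {α : c_α ≠ 0}. Then (1 − ε·card(S)) · ∑_{|α|=ℓ} |c_α|² ≤ ‖∑_{|α|=ℓ} (ℓ!/α!)^{1/2} c_α T^α ξ‖². -/

import Mathlib

open ContinuousLinearMap

/-- `T^α = T_1^{α_1} ⋯ T_d^{α_d}`. -/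
noncomputable def opProd {H : Type*} [NormedAddCommGroup H] [InnerProductSpace ℂ H]
    {d : ℕ} (T : Fin d → H →L[ℂ] H) (α : Fin d → ℕ) : H →L[ℂ] H :=
  (List.ofFn fun i => (T i) ^ (α i)).prod

section Grammian

variable {ι E : Type*} [NormedAddCommGroup E] [InnerProductSpace ℂ E]

theorem sum_sum_norm_sub_sq (s : Finset ι) (w : ι → E) :
    ∑ i ∈ s, ∑ j ∈ s, ‖w i - w j‖ ^ 2 =
      2 * (s.card * ∑ i ∈ s, ‖w i‖ ^ 2) - 2 * ‖∑ i ∈ s, w i‖ ^ 2 := by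
  have h : ‖∑ i ∈ s, w i‖ ^ 2 = ∑ i ∈ s, ∑ j ∈ s, RCLike.re (inner ℂ (w i) (w j)) := by
    rw [← inner_self_eq_norm_sq (𝕜 := ℂ), sum_inner, map_sum]
    simp only [inner_sum, map_sum]
  simp only [norm_sub_sq (𝕜 := ℂ), Finset.sum_add_distrib, Finset.sum_sub_distrib,
    ← Finset.mul_sum, Finset.sum_const, nsmul_eq_mul, h]
  ring

/-- If `v` has squared norms at least `1 - ε` and any two of the vectors `c i • v i` satisfy
the inequality `‖c i • v i - c j • v j‖² ≤ |c i|² + |c j|²` then the Grammian of `v` is bounded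
below by `1 - ε * card s` at `c`. -/
theorem one_sub_mul_card_mul_sum_le (s : Finset ι) (v : ι → E) (c : ι → ℂ) {ε : ℝ}
    (hv : ∀ i ∈ s, 1 - ε ≤ ‖v i‖ ^ 2)
    (hc : ∀ i ∈ s, ∀ j ∈ s, i ≠ j →
      ‖c i • v i - c j • v j‖ ^ 2 ≤ ‖c i‖ ^ 2 + ‖c j‖ ^ 2) :
    (1 - ε * s.card) * ∑ i ∈ s, ‖c i‖ ^ 2 ≤ ‖∑ i ∈ s, c i • v i‖ ^ 2 := by
  classical
  have hdiag : (1 - ε) * ∑ i ∈ s, ‖c i‖ ^ 2 ≤ ∑ i ∈ s, ‖c i • v i‖ ^ 2 := by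
    rw [Finset.mul_sum]
    refine Finset.sum_le_sum fun i hi => ?_
    rw [norm_smul, mul_pow, mul_comm]
    exact mul_le_mul_of_nonneg_left (hv i hi) (by positivity)
  have hoff : ∑ i ∈ s, ∑ j ∈ s, ‖c i • v i - c j • v j‖ ^ 2 ≤
      2 * (s.card * ∑ i ∈ s, ‖c i‖ ^ 2) - 2 * ∑ i ∈ s, ‖c i‖ ^ 2 := by
    calc _ ≤ ∑ i ∈ s, ∑ j ∈ s,
          (‖c i‖ ^ 2 + ‖c j‖ ^ 2 - if i = j then 2 * ‖c i‖ ^ 2 else 0) := by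
          refine Finset.sum_le_sum fun i hi => Finset.sum_le_sum fun j hj => ?_
          split_ifs with hij
          · subst hij
            simp [two_mul]
          · simpa using hc i hi j hj hij
      _ = _ := by
          simp only [Finset.sum_sub_distrib, Finset.sum_add_distrib, Finset.sum_const,
            nsmul_eq_mul, Finset.sum_ite_eq, ← Finset.mul_sum]
          rw [Finset.sum_ite_mem, Finset.inter_self, ← Finset.mul_sum]
          ring
  rw [sum_sum_norm_sub_sq s fun i => c i • v i] at hoff
  have := mul_le_mul_of_nonneg_left hdiag (Nat.cast_nonneg (α := ℝ) s.card)
  linarith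

end Grammian

theorem opProd_eq_noncommProd {H : Type*} [NormedAddCommGroup H] [InnerProductSpace ℂ H]
    {d : ℕ} {T : Fin d → H →L[ℂ] H} (α : Fin d → ℕ)
    (hcomm : ((Finset.univ : Finset (Fin d)) : Set (Fin d)).Pairwise
      (Function.onFun Commute fun i => T i ^ α i)) :
    opProd T α = Finset.univ.noncommProd (fun i => T i ^ α i) hcomm := by
  have h := Finset.noncommProd_toFinset (List.finRange d) (fun i => T i ^ α i)
    (by simpa using hcomm) (List.nodup_finRange d)
  rw [opProd, List.ofFn_eq_map, ← h]
  exact Finset.noncommProd_congr (List.toFinset_finRange d) (fun _ _ => rfl) _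

section RowContraction

variable {H : Type*} [NormedAddCommGroup H] [InnerProductSpace ℂ H] [CompleteSpace H]

/-- The representation of operators on `H` on functions `H → ℝ` by composition with the adjoint. -/
noncomputable def adjointComp : (H →L[ℂ] H) →* Module.End ℝ (H → ℝ) where
  toFun A := LinearMap.funLeft ℝ ℝ (adjoint A)
  map_one' := by
    ext f x
    simp [LinearMap.funLeft_apply, ← ContinuousLinearMap.star_eq_adjoint]
  map_mul' A B := by
    ext f x
    simp [LinearMap.funLeft_apply, ← ContinuousLinearMap.star_eq_adjoint]

@[simp]
theorem adjointComp_apply (A : H →L[ℂ] H) (f : H → ℝ) (x : H) :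
    adjointComp A f x = f (adjoint A x) := rfl

theorem sum_norm_adjoint_sq_le {ι : Type*} {s : Finset ι} {T : ι → H →L[ℂ] H}
    (hrow : (1 - ∑ k ∈ s, T k * adjoint (T k)).IsPositive) (x : H) :
    ∑ k ∈ s, ‖adjoint (T k) x‖ ^ 2 ≤ ‖x‖ ^ 2 := by
  have h := hrow.re_inner_nonneg_left x
  simp only [sub_apply, one_apply_eq_self, sum_apply, mul_apply_eq_comp, inner_sub_left,
    sum_inner, map_sub, map_sum, ← ContinuousLinearMap.adjoint_inner_right (T _),
    inner_self_eq_norm_sq] at h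
  linarith

theorem sum_adjointComp_pow_le {ι : Type*} {s : Finset ι} {T : ι → H →L[ℂ] H} {f : H → ℝ}
    (hf : (∑ k ∈ s, adjointComp (T k)) f ≤ f) (n : ℕ) :
    ((∑ k ∈ s, adjointComp (T k)) ^ n) f ≤ f := by
  induction n with
  | zero => simp
  | succ n ih =>
    refine le_trans (fun x => ?_) hf
    rw [pow_succ', Module.End.mul_apply, LinearMap.sum_apply, LinearMap.sum_apply,
      Finset.sum_apply, Finset.sum_apply]
    exact Finset.sum_le_sum fun k _ => ih _

variable {d : ℕ} {T : Fin d → H →L[ℂ] H}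

theorem sum_multinomial_mul_norm_adjoint_opProd_sq_le
    (hcomm : ∀ i j, Commute (T i) (T j))
    (hrow : (1 - ∑ k, T k * adjoint (T k)).IsPositive) (ℓ : ℕ) (x : H) :
    ∑ α ∈ Finset.Nat.antidiagonalTuple d ℓ,
      ((ℓ.factorial : ℝ) / (∏ i, ((α i).factorial : ℝ))) * ‖adjoint (opProd T α) x‖ ^ 2 ≤
        ‖x‖ ^ 2 := by
  have h := sum_adjointComp_pow_le (s := Finset.univ) (T := T) (f := fun x => ‖x‖ ^ 2)
    (fun x => by simpa using sum_norm_adjoint_sq_le hrow x) ℓ x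
  rw [Finset.sum_pow_eq_sum_piAntidiag_of_commute _ _
    (fun i _ j _ _ => (hcomm i j).map adjointComp), LinearMap.sum_apply, Finset.sum_apply,
    Finset.piAntidiag_univ_fin_eq_antidiagonalTuple] at h
  refine le_of_eq_of_le (Finset.sum_congr rfl fun α hα => ?_) h
  have hmult : (Nat.multinomial Finset.univ α : ℝ) =
      (ℓ.factorial : ℝ) / ∏ i, ((α i).factorial : ℝ) := by
    rw [Nat.multinomial, Finset.Nat.mem_antidiagonalTuple.1 hα,
      Nat.cast_div (Finset.Nat.mem_antidiagonalTuple.1 hα ▸ Nat.prod_factorial_dvd_factorial_sum _ _)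
        (by simp [Finset.prod_eq_zero_iff, Nat.factorial_ne_zero])]
    simp
  have hpow : ((Finset.univ : Finset (Fin d)) : Set (Fin d)).Pairwise
      (Function.onFun Commute fun i => T i ^ α i) :=
    fun i _ j _ _ => (hcomm i j).pow_pow _ _
  have hprod := Finset.map_noncommProd Finset.univ (fun i => T i ^ α i) hpow adjointComp
  simp only [map_pow] at hprod
  rw [← hmult, ← hprod, ← opProd_eq_noncommProd α hpow, ← nsmul_eq_mul (α := Module.End ℝ (H → ℝ)),
    LinearMap.smul_apply]
  simp

theorem norm_sum_smul_opProd_sq_le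
    (hcomm : ∀ i j, Commute (T i) (T j))
    (hrow : (1 - ∑ k, T k * adjoint (T k)).IsPositive) {ξ : H} (hξ : ‖ξ‖ = 1) {ℓ : ℕ}
    {t : Finset (Fin d → ℕ)} (ht : t ⊆ Finset.Nat.antidiagonalTuple d ℓ)
    (c : (Fin d → ℕ) → ℂ) :
    ‖∑ α ∈ t, c α • ((Real.sqrt ((ℓ.factorial : ℝ) / (∏ i, ((α i).factorial : ℝ))) : ℂ) •
      opProd T α ξ)‖ ^ 2 ≤ ∑ α ∈ t, ‖c α‖ ^ 2 := by
  set m : (Fin d → ℕ) → ℝ := fun α => (ℓ.factorial : ℝ) / ∏ i, ((α i).factorial : ℝ) with hm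
  have hm0 : ∀ α, 0 ≤ m α := fun α => by positivity
  set y := ∑ α ∈ t, c α • ((Real.sqrt (m α) : ℂ) • opProd T α ξ) with hy
  have hsum : ∑ α ∈ t, (Real.sqrt (m α) * ‖adjoint (opProd T α) y‖) ^ 2 ≤ ‖y‖ ^ 2 := by
    refine le_trans (Finset.sum_le_sum_of_subset_of_nonneg ht fun _ _ _ => by positivity) ?_
    simp only [mul_pow, Real.sq_sqrt (hm0 _)]
    exact sum_multinomial_mul_norm_adjoint_opProd_sq_le hcomm hrow ℓ y
  have hle : ‖y‖ ^ 2 ≤ ∑ α ∈ t, ‖c α‖ * (Real.sqrt (m α) * ‖adjoint (opProd T α) y‖) := by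
    calc ‖y‖ ^ 2 = ‖inner ℂ y y‖ := by simp [inner_self_eq_norm_sq_to_K]
      _ = ‖∑ α ∈ t, c α * ((Real.sqrt (m α) : ℂ) * inner ℂ (adjoint (opProd T α) y) ξ)‖ := by
          conv_lhs => rw [hy, inner_sum, ← hy]
          simp only [inner_smul_right, ContinuousLinearMap.adjoint_inner_left]
      _ ≤ _ := by
          refine (norm_sum_le _ _).trans (Finset.sum_le_sum fun α _ => ?_)
          rw [norm_mul, norm_mul, Complex.norm_real, Real.norm_of_nonneg (Real.sqrt_nonneg _)]
          have := norm_inner_le_norm (𝕜 := ℂ) (adjoint (opProd T α) y) ξ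
          rw [hξ, mul_one] at this
          gcongr
  have hcs := Finset.sum_mul_sq_le_sq_mul_sq t (fun α => ‖c α‖)
    fun α => Real.sqrt (m α) * ‖adjoint (opProd T α) y‖
  have hc0 : 0 ≤ ∑ α ∈ t, ‖c α‖ ^ 2 := by positivity
  rcases (sq_nonneg ‖y‖).eq_or_lt with h0 | h0
  · rwa [← h0]
  · refine le_of_mul_le_mul_right ?_ h0
    calc ‖y‖ ^ 2 * ‖y‖ ^ 2 = (‖y‖ ^ 2) ^ 2 := (sq _).symm
      _ ≤ _ := pow_le_pow_left₀ h0.le hle 2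
      _ ≤ _ := hcs
      _ ≤ _ := mul_le_mul_of_nonneg_left hsum hc0

end RowContraction

open Classical in
/-- lower Grammian estimate for a commuting row contraction at a fixed
homogeneity level `ℓ`. -/
theorem stmt3 {H : Type*} [NormedAddCommGroup H] [InnerProductSpace ℂ H] [CompleteSpace H]
    {d : ℕ} (T : Fin d → H →L[ℂ] H)
    (hcomm : ∀ i j, Commute (T i) (T j))
    (hrow : (1 - ∑ k, T k * adjoint (T k)).IsPositive)
    (ξ : H) (hξ : ‖ξ‖ = 1) (ℓ : ℕ) (ε : ℝ) (hε : 0 < ε)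
    (hbelow : ∀ α ∈ Finset.Nat.antidiagonalTuple d ℓ,
      1 - ε ≤ ((ℓ.factorial : ℝ) / (∏ i, ((α i).factorial : ℝ))) * ‖opProd T α ξ‖ ^ 2)
    (c : (Fin d → ℕ) → ℂ) :
    (1 - ε * ((Finset.Nat.antidiagonalTuple d ℓ).filter fun α => c α ≠ 0).card) *
        ∑ α ∈ Finset.Nat.antidiagonalTuple d ℓ, ‖c α‖ ^ 2 ≤
      ‖∑ α ∈ Finset.Nat.antidiagonalTuple d ℓ,
          c α • ((Real.sqrt ((ℓ.factorial : ℝ) / (∏ i, ((α i).factorial : ℝ))) : ℂ) •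
            opProd T α ξ)‖ ^ 2 := by
  have h := one_sub_mul_card_mul_sum_le
    ((Finset.Nat.antidiagonalTuple d ℓ).filter fun α => c α ≠ 0)
    (fun α => (Real.sqrt ((ℓ.factorial : ℝ) / (∏ i, ((α i).factorial : ℝ))) : ℂ) • opProd T α ξ)
    c (ε := ε) (fun α hα => ?_) fun α hα β hβ hne => ?_
  · rwa [Finset.sum_filter_of_ne fun α _ => mt fun hc => by simp [hc],
      Finset.sum_filter_of_ne fun α _ => mt fun hc => by simp [hc]] at h
  · rw [norm_smul, mul_pow, Complex.norm_real, Real.norm_of_nonneg (Real.sqrt_nonneg _),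
      Real.sq_sqrt (by positivity)]
    exact hbelow α (Finset.mem_filter.1 hα).1
  · have h := norm_sum_smul_opProd_sq_le hcomm hrow hξ (ℓ := ℓ) (t := {α, β})
      (by
        rw [Finset.insert_subset_iff, Finset.singleton_subset_iff]
        exact ⟨(Finset.mem_filter.1 hα).1, (Finset.mem_filter.1 hβ).1⟩)
      (Function.update c β (-c β))
    rw [Finset.sum_pair hne, Finset.sum_pair hne] at h
    simpa only [Function.update_self, Function.update_of_ne hne, norm_neg, neg_smul,
      ← sub_eq_add_neg] using h
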